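/- Let n ≥ 1 and let 𝒜 ⊆ M_n(ℂ) be a logmodular subalgebra. Then 𝒜 is unitarily equivalent to an algebra of block upper triangular matrices; that is, there exist a unitary U ∈ M_n(ℂ) and a partition n = n_1 + ... + n_r such that U 𝒜 U* equals the algebra of all matrices that are block upper triangular with respect to the decomposition ℂ^n = ℂ^{n_1} ⊕ ... ⊕ ℂ^{n_r}. -/

import Mathlib

open scoped ComplexOrder

/-- A (closed unital) subalgebra `A ⊆ Mₙ(ℂ)` is *logmodular* if the set
`{a* a : a ∈ A, a invertible in A}` is dense in the set of positive invertible
(i.e. positive definite) matrices. -/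
def IsLogmodular {n : ℕ} (A : Subalgebra ℂ (Matrix (Fin n) (Fin n) ℂ)) : Prop :=
  ∀ b : Matrix (Fin n) (Fin n) ℂ, b.PosDef →
    b ∈ closure {x : Matrix (Fin n) (Fin n) ℂ |
      ∃ a ∈ A, (∃ a' ∈ A, a * a' = 1 ∧ a' * a = 1) ∧ x = star a * a}

open Matrix

section LogmodularFactorization

open scoped Matrix.Norms.L2Operator

/-- In a logmodular subalgebra every positive semidefinite matrix factors as `a* a`. -/
theorem IsLogmodular.exists_star_mul_self_eq {n : ℕ}
    {A : Subalgebra ℂ (Matrix (Fin n) (Fin n) ℂ)}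
    (hclosed : IsClosed (A : Set (Matrix (Fin n) (Fin n) ℂ))) (hlog : IsLogmodular A)
    {b : Matrix (Fin n) (Fin n) ℂ} (hb : b.PosSemidef) :
    ∃ a ∈ A, star a * a = b := by
  have : ProperSpace (Matrix (Fin n) (Fin n) ℂ) := FiniteDimensional.proper ℂ _
  have hproper : IsProperMap (fun a : Matrix (Fin n) (Fin n) ℂ => star a * a) := by
    rw [isProperMap_iff_tendsto_cocompact]
    refine ⟨by fun_prop, ?_⟩
    rw [← Metric.cobounded_eq_cocompact, ← comap_norm_atTop, Filter.tendsto_comap_iff]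
    simp only [Function.comp_def, CStarRing.norm_star_mul_self]
    exact (Filter.tendsto_mul_self_atTop).comp Filter.tendsto_comap
  have himage := hproper.isClosedMap _ hclosed
  have hpos : ∀ c : Matrix (Fin n) (Fin n) ℂ, c.PosDef →
      c ∈ (fun a : Matrix (Fin n) (Fin n) ℂ => star a * a) '' A := by
    intro c hc
    refine closure_minimal ?_ himage (hlog c hc)
    rintro x ⟨a, ha, -, rfl⟩
    exact ⟨a, ha, rfl⟩
  have hlim : Filter.Tendsto
      (fun k : ℕ => b + (((1 / ((k : ℝ) + 1) : ℝ)) : ℂ) • (1 : Matrix (Fin n) (Fin n) ℂ))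
      Filter.atTop (nhds b) := by
    have h1 : Filter.Tendsto (fun k : ℕ => (((1 / ((k : ℝ) + 1) : ℝ)) : ℂ))
        Filter.atTop (nhds 0) := by
      simpa [Function.comp_def] using (Complex.continuous_ofReal.tendsto 0).comp
        (tendsto_one_div_add_atTop_nhds_zero_nat (𝕜 := ℝ))
    simpa using tendsto_const_nhds.add (h1.smul_const (1 : Matrix (Fin n) (Fin n) ℂ))
  refine himage.mem_of_tendsto hlim (Filter.Eventually.of_forall fun k => hpos _ ?_)
  refine Matrix.PosDef.posSemidef_add hb (Matrix.PosDef.one.smul ?_)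
  exact_mod_cast Nat.one_div_pos_of_nat

end LogmodularFactorization

/-- Every subspace of `ℂⁿ` is the range of a self-adjoint idempotent matrix. -/
theorem Matrix.exists_isHermitian_projection {n : ℕ} (G : Submodule ℂ (Fin n → ℂ)) :
    ∃ P : Matrix (Fin n) (Fin n) ℂ, P.IsHermitian ∧ (∀ x, P *ᵥ x ∈ G) ∧ ∀ x ∈ G, P *ᵥ x = x := by
  let e := (WithLp.linearEquiv 2 ℂ (Fin n → ℂ))
  let K : Submodule ℂ (EuclideanSpace ℂ (Fin n)) := G.comap e.toLinearMap
  let T : EuclideanSpace ℂ (Fin n) →ₗ[ℂ] EuclideanSpace ℂ (Fin n) := K.starProjection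
  have hT : Matrix.toEuclideanLin (Matrix.toEuclideanLin.symm T) = T :=
    LinearEquiv.apply_symm_apply _ _
  have happ : ∀ x : Fin n → ℂ,
      (Matrix.toEuclideanLin.symm T) *ᵥ x = (T (WithLp.toLp 2 x)).ofLp := by
    intro x
    conv_rhs => rw [← hT]
    rfl
  refine ⟨Matrix.toEuclideanLin.symm T, ?_, fun x => ?_, fun x hx => ?_⟩
  · rw [← Matrix.isSymmetric_toEuclideanLin_iff, hT]
    exact K.starProjection_isSymmetric
  · rw [happ]
    exact K.starProjection_apply_mem (WithLp.toLp 2 x)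
  · rw [happ]
    have : T (WithLp.toLp 2 x) = WithLp.toLp 2 x :=
      Submodule.starProjection_eq_self_iff.2 (show WithLp.toLp 2 x ∈ K from hx)
    rw [this]

/-- If `P` is a self-adjoint idempotent whose range is invariant under `A` and `c ∈ A` satisfies
`c* c = P`, then `P` belongs to `A`, and `c c* = P`. -/
theorem Subalgebra.projection_mem_of_star_mul_self_eq {n : ℕ}
    {A : Subalgebra ℂ (Matrix (Fin n) (Fin n) ℂ)} {P c : Matrix (Fin n) (Fin n) ℂ}
    (hP : star P = P) (hPP : P * P = P) (hinv : ∀ a ∈ A, P * (a * P) = a * P)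
    (hc : c ∈ A) (hcP : star c * c = P) : P ∈ A ∧ c * star c = P := by
  have hcP' : c * P = c := by
    have h0 : star (c - c * P) * (c - c * P) = 0 := by
      simp only [star_sub, star_mul, hP]
      have e1 : (star c - P * star c) * (c - c * P)
          = star c * c - (star c * c) * P - P * (star c * c) + P * (star c * c) * P := by
        noncomm_ring
      rw [e1, hcP, hPP, hPP]
      simp
    exact (sub_eq_zero.1 (Matrix.conjTranspose_mul_self_eq_zero.1 h0)).symm
  have hPc : P * c = c := by
    have := hinv c hc
    rwa [hcP'] at this
  let I : Submodule ℂ (Matrix (Fin n) (Fin n) ℂ) :=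
    Subalgebra.toSubmodule A ⊓ LinearMap.eqLocus (LinearMap.mulLeft ℂ P) LinearMap.id
  have hI : ∀ x, x ∈ I ↔ x ∈ A ∧ P * x = x := fun x => Iff.rfl
  have hmaps : ∀ x ∈ I, LinearMap.mulLeft ℂ c x ∈ I := by
    intro x hx
    rw [hI] at hx ⊢
    refine ⟨A.mul_mem hc hx.1, ?_⟩
    rw [LinearMap.mulLeft_apply, ← mul_assoc, hPc]
  have hinj : Function.Injective ((LinearMap.mulLeft ℂ c).restrict hmaps) := by
    rw [← LinearMap.ker_eq_bot, LinearMap.ker_eq_bot']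
    rintro ⟨x, hx⟩ h
    have h' : c * x = 0 := congrArg Subtype.val h
    have : x = 0 := by rw [← ((hI x).1 hx).2, ← hcP, mul_assoc, h', mul_zero]
    exact Subtype.ext this
  have hsurj := LinearMap.injective_iff_surjective.1 hinj
  have hex : ∀ z ∈ I, ∃ x ∈ I, c * x = z := by
    intro z hz
    obtain ⟨x, hx⟩ := hsurj ⟨z, hz⟩
    exact ⟨x, x.2, congrArg Subtype.val hx⟩
  obtain ⟨x, hx, hcx⟩ := hex c ⟨hc, hPc⟩
  have hxP : x = P := by rw [← ((hI x).1 hx).2, ← hcP, mul_assoc, hcx]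
  have hPA : P ∈ A := hxP ▸ ((hI x).1 hx).1
  obtain ⟨y, hy, hcy⟩ := hex P ⟨hPA, hPP⟩
  have hyc : y = star c := by
    rw [← ((hI y).1 hy).2, ← hcP, mul_assoc, hcy]
    simpa [hP] using congrArg star hPc
  exact ⟨hPA, hyc ▸ hcy⟩

/-- If `a` leaves the range `G` of the projection `P` invariant, then `P a P = a P`. -/
theorem Matrix.mul_projection_eq_of_invariant {n : ℕ} {G : Submodule ℂ (Fin n → ℂ)}
    {P a : Matrix (Fin n) (Fin n) ℂ} (hPG : ∀ x, P *ᵥ x ∈ G) (hPx : ∀ x ∈ G, P *ᵥ x = x)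
    (ha : ∀ x ∈ G, a *ᵥ x ∈ G) : P * (a * P) = a * P := by
  refine Matrix.ext_of_mulVec_single fun i => ?_
  rw [← Matrix.mulVec_mulVec, ← Matrix.mulVec_mulVec]
  exact hPx _ (ha _ (hPG _))

/-- The orthogonal projection onto a subspace invariant under a logmodular algebra belongs to
the algebra. -/
theorem IsLogmodular.exists_projection_mem {n : ℕ}
    {A : Subalgebra ℂ (Matrix (Fin n) (Fin n) ℂ)}
    (hclosed : IsClosed (A : Set (Matrix (Fin n) (Fin n) ℂ))) (hlog : IsLogmodular A)
    {G : Submodule ℂ (Fin n → ℂ)} (hG : ∀ a ∈ A, ∀ x ∈ G, a *ᵥ x ∈ G) :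
    ∃ P ∈ A, star P = P ∧ P * P = P ∧ (∀ x, P *ᵥ x ∈ G) ∧ ∀ x ∈ G, P *ᵥ x = x := by
  obtain ⟨P, hP, hPG, hPx⟩ := Matrix.exists_isHermitian_projection G
  have hPs : star P = P := hP
  have hPP : P * P = P := by
    simpa using Matrix.mul_projection_eq_of_invariant (a := 1) hPG hPx (by simp)
  have hpsd : P.PosSemidef := by
    have := Matrix.posSemidef_conjTranspose_mul_self P
    rwa [hP.eq, hPP] at this
  obtain ⟨c, hc, hcP⟩ := hlog.exists_star_mul_self_eq hclosed hpsd
  exact ⟨P, (Subalgebra.projection_mem_of_star_mul_self_eq hPs hPP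
    (fun a ha => Matrix.mul_projection_eq_of_invariant hPG hPx (hG a ha)) hc hcP).1,
    hPs, hPP, hPG, hPx⟩

/-- If `v ≠ 0` is orthogonal to an invariant subspace `G` of a logmodular algebra, the algebra
contains a rank one matrix `w v*` with `w` outside `G`. -/
theorem IsLogmodular.exists_vecMulVec_mem {n : ℕ}
    {A : Subalgebra ℂ (Matrix (Fin n) (Fin n) ℂ)}
    (hclosed : IsClosed (A : Set (Matrix (Fin n) (Fin n) ℂ))) (hlog : IsLogmodular A)
    {G : Submodule ℂ (Fin n → ℂ)} (hG : ∀ a ∈ A, ∀ x ∈ G, a *ᵥ x ∈ G)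
    {v : Fin n → ℂ} (hv : v ≠ 0) (hvG : ∀ x ∈ G, star x ⬝ᵥ v = 0) :
    ∃ w ∉ G, vecMulVec w (star v) ∈ A := by
  obtain ⟨P, hPA, hP, hPP, hPG, hPx⟩ := hlog.exists_projection_mem hclosed hG
  have hPv : P *ᵥ v = 0 := by
    rw [← dotProduct_star_self_eq_zero]
    have h1 : star (P *ᵥ v) ⬝ᵥ (P *ᵥ v) = star (P *ᵥ (P *ᵥ v)) ⬝ᵥ v := by
      rw [Matrix.star_mulVec (P) (P *ᵥ v), ← Matrix.dotProduct_mulVec]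
      change _ = star (P *ᵥ v) ⬝ᵥ (star P *ᵥ v)
      rw [hP]
    rw [h1]
    exact hvG _ (hPG _)
  have hvP : star v ᵥ* P = 0 := by
    have h := congrArg star hPv
    rw [Matrix.star_mulVec, star_zero] at h
    change star v ᵥ* star P = 0 at h
    rwa [hP] at h
  have hvv : star v ⬝ᵥ v ≠ 0 := fun h => hv (dotProduct_star_self_eq_zero.1 h)
  have hpsd : (P + vecMulVec v (star v)).PosSemidef := by
    refine Matrix.PosSemidef.add ?_ (Matrix.posSemidef_vecMulVec_self_star v)
    have := Matrix.posSemidef_conjTranspose_mul_self P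
    change (star P * P).PosSemidef at this
    rwa [hP, hPP] at this
  obtain ⟨a, ha, hab⟩ := hlog.exists_star_mul_self_eq hclosed hpsd
  have hc : star (a * P) * (a * P) = P := by
    rw [star_mul, hP, mul_assoc, ← mul_assoc (star a), hab, add_mul, vecMulVec_mul, hvP, hPP]
    simp [hPP]
  obtain ⟨-, hcc⟩ := Subalgebra.projection_mem_of_star_mul_self_eq hP hPP
    (fun a ha => Matrix.mul_projection_eq_of_invariant hPG hPx (hG a ha)) (A.mul_mem ha hPA) hc
  have habv : star a *ᵥ (a *ᵥ v) = (star v ⬝ᵥ v) • v := by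
    rw [mulVec_mulVec, hab, add_mulVec, hPv, vecMulVec_mulVec]
    simp
  have hPav : P *ᵥ (a *ᵥ v) = 0 := by
    rw [← hcc, star_mul, hP, ← mulVec_mulVec, ← mulVec_mulVec, ← mulVec_mulVec, habv, mulVec_smul,
      hPv]
    simp
  have hav : a *ᵥ v ≠ 0 := by
    intro h
    rw [h, mulVec_zero] at habv
    exact (smul_ne_zero hvv hv) habv.symm
  refine ⟨a *ᵥ v, fun h => hav ?_, ?_⟩
  · rw [← hPx _ h, hPav]
  · have hq : a * ((star v ⬝ᵥ v) • (1 - P) - vecMulVec v (star v)) = 0 := by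
      apply Matrix.conjTranspose_mul_self_eq_zero.1
      set q := (star v ⬝ᵥ v) • (1 - P) - vecMulVec v (star v) with hq
      have hbq : (star a * a) * q = 0 := by
        rw [hab, hq, mul_sub, add_mul, add_mul, Matrix.mul_smul, Matrix.mul_smul, mul_sub, mul_sub,
          hPP, mul_vecMulVec, hPv, vecMulVec_mul_vecMulVec, vecMulVec_mul, vecMulVec_mul, hvP]
        simp [vecMulVec_smul]
      change star (a * q) * (a * q) = 0
      rw [star_mul, mul_assoc, ← mul_assoc (star a), hbq, mul_zero]
    rw [mul_sub, mul_vecMulVec, sub_eq_zero] at hq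
    rw [← hq]
    exact A.mul_mem ha (A.smul_mem (A.sub_mem A.one_mem hPA) _)

/-- The vectors `w` such that the rank one matrix `w v*` belongs to `A`. -/
def Subalgebra.rankOneLeft {n : ℕ} (A : Subalgebra ℂ (Matrix (Fin n) (Fin n) ℂ))
    (v : Fin n → ℂ) : Submodule ℂ (Fin n → ℂ) where
  carrier := {w | vecMulVec w (star v) ∈ A}
  add_mem' := by
    intro x y hx hy
    simp only [Set.mem_ofPred_eq, add_vecMulVec] at *
    exact A.add_mem hx hy
  zero_mem' := by simp
  smul_mem' := by
    intro c x hx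
    simp only [Set.mem_ofPred_eq, smul_vecMulVec] at *
    exact A.smul_mem hx c

theorem Subalgebra.mem_rankOneLeft {n : ℕ} {A : Subalgebra ℂ (Matrix (Fin n) (Fin n) ℂ)}
    {v w : Fin n → ℂ} : w ∈ A.rankOneLeft v ↔ vecMulVec w (star v) ∈ A := Iff.rfl

theorem Subalgebra.mulVec_mem_rankOneLeft {n : ℕ} {A : Subalgebra ℂ (Matrix (Fin n) (Fin n) ℂ)}
    {v : Fin n → ℂ} : ∀ a ∈ A, ∀ w ∈ A.rankOneLeft v, a *ᵥ w ∈ A.rankOneLeft v := by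
  intro a ha w hw
  rw [Subalgebra.mem_rankOneLeft, ← mul_vecMulVec]
  exact A.mul_mem ha hw

/-- For every `v ≠ 0` there is `z ≠ 0` such that the logmodular algebra contains `z z*`, and `z` is
orthogonal to each `u` orthogonal to `v` for which the algebra contains `u u*`. -/
theorem IsLogmodular.exists_vecMulVec_self_mem {n : ℕ}
    {A : Subalgebra ℂ (Matrix (Fin n) (Fin n) ℂ)}
    (hclosed : IsClosed (A : Set (Matrix (Fin n) (Fin n) ℂ))) (hlog : IsLogmodular A)
    {v : Fin n → ℂ} (hv : v ≠ 0) :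
    ∃ z ≠ 0, vecMulVec z (star z) ∈ A ∧
      ∀ u : Fin n → ℂ, vecMulVec u (star u) ∈ A → star u ⬝ᵥ v = 0 → star u ⬝ᵥ z = 0 := by
  have hW := Subalgebra.mulVec_mem_rankOneLeft (A := A) (v := v)
  obtain ⟨P, hPA, hP, hPP, hPG, hPx⟩ := hlog.exists_projection_mem hclosed hW
  have hstar : star (P *ᵥ v) = star v ᵥ* P := by
    rw [Matrix.star_mulVec]
    change star v ᵥ* star P = _
    rw [hP]
  refine ⟨P *ᵥ v, fun h0 => ?_, ?_, fun u hu huv => ?_⟩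
  · obtain ⟨w, hwG, hw⟩ := hlog.exists_vecMulVec_mem hclosed hW hv (by
      intro x hx
      rw [← hPx x hx, Matrix.star_mulVec, ← dotProduct_mulVec]
      change star x ⬝ᵥ (star P *ᵥ v) = 0
      rw [hP, h0, dotProduct_zero])
    exact hwG hw
  · rw [hstar, ← vecMulVec_mul]
    exact A.mul_mem (hPG v) hPA
  · by_cases hu0 : u = 0
    · simp [hu0]
    have h1 := Matrix.mul_projection_eq_of_invariant hPG hPx (hW _ hu)
    have h2 : vecMulVec u (star u) * P = P * vecMulVec u (star u) := by
      have h3 := congrArg star h1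
      have hus : star (vecMulVec u (star u)) = vecMulVec u (star u) := by
        simp [Matrix.star_eq_conjTranspose, conjTranspose_vecMulVec]
      rw [star_mul, star_mul, hP, hus, mul_assoc] at h3
      rw [← h1, h3]
    have h4 : vecMulVec u (star u) *ᵥ (P *ᵥ v) = 0 := by
      rw [mulVec_mulVec, h2, ← mulVec_mulVec, vecMulVec_mulVec, huv]
      simp
    rw [vecMulVec_mulVec] at h4
    simpa [hu0] using h4

/-- A logmodular algebra contains the rank one projections onto the vectors of some orthonormal
basis. -/
theorem IsLogmodular.exists_orthonormal_vecMulVec_mem {n : ℕ}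
    {A : Subalgebra ℂ (Matrix (Fin n) (Fin n) ℂ)}
    (hclosed : IsClosed (A : Set (Matrix (Fin n) (Fin n) ℂ))) (hlog : IsLogmodular A) :
    ∃ u : Fin n → Fin n → ℂ, (∀ i j, star (u i) ⬝ᵥ u j = if i = j then 1 else 0) ∧
      ∀ i, vecMulVec (u i) (star (u i)) ∈ A := by
  suffices h : ∀ k ≤ n, ∃ u : Fin k → Fin n → ℂ,
      (∀ i j, star (u i) ⬝ᵥ u j = if i = j then 1 else 0) ∧
      ∀ i, vecMulVec (u i) (star (u i)) ∈ A from h n le_rfl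
  intro k
  induction k with
  | zero => exact fun _ => ⟨Fin.elim0, fun i => i.elim0, fun i => i.elim0⟩
  | succ k ih =>
    intro hk
    obtain ⟨u, hu, huA⟩ := ih (by omega)
    obtain ⟨v, hv, hv0⟩ : ∃ v : Fin n → ℂ, v ≠ 0 ∧ ∀ i, star (u i) ⬝ᵥ v = 0 := by
      have hker := LinearMap.ker_ne_bot_of_finrank_lt
        (f := Matrix.mulVecLin (Matrix.of fun i => star (u i))) (by simpa using hk)
      obtain ⟨v, hv, hv0⟩ := Submodule.exists_mem_ne_zero_of_ne_bot hker
      exact ⟨v, hv0, fun i => congrFun hv i⟩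
    obtain ⟨z, hz, hzA, hzu⟩ := hlog.exists_vecMulVec_self_mem hclosed hv
    obtain ⟨c, hc⟩ : ∃ c : ℂ, star c * c * (star z ⬝ᵥ z) = 1 := by
      obtain ⟨r, hr, hrz⟩ := RCLike.pos_iff_exists_ofReal.1 (dotProduct_star_self_pos_iff.2 hz)
      refine ⟨((√r)⁻¹ : ℝ), ?_⟩
      rw [← hrz]
      simp only [Complex.star_def, Complex.conj_ofReal, Complex.coe_algebraMap]
      norm_cast
      rw [← mul_inv, Real.mul_self_sqrt hr.le, inv_mul_cancel₀ hr.ne']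
    have hzu' : ∀ i, star (u i) ⬝ᵥ z = 0 := fun i => hzu _ (huA i) (hv0 i)
    have huz' : ∀ i, star z ⬝ᵥ u i = 0 := fun i => by
      rw [star_dotProduct, hzu' i, star_zero]
    refine ⟨Fin.snoc u (c • z), fun i j => ?_, fun i => ?_⟩
    · induction i using Fin.lastCases <;> induction j using Fin.lastCases
      · simpa [mul_assoc, mul_left_comm] using hc
      · simp [huz', (Fin.castSucc_lt_last _).ne']
      · simp [hzu', (Fin.castSucc_lt_last _).ne]
      · simp [hu]
    · induction i using Fin.lastCases
      · simp only [Fin.snoc_last, star_smul, vecMulVec_smul, smul_vecMulVec]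
        exact A.smul_mem (A.smul_mem hzA _) _
      · simpa using huA _

/-- Every logmodular subalgebra of `Mₙ(ℂ)` is unitarily equivalent to an algebra of
block upper triangular matrices (the blocks being the fibers of a monotone map
`f : Fin n → ℕ`, corresponding to a partition `n = n₁ + ⋯ + n_r`). -/
theorem logmodular_unitarily_equiv_blockUpperTriangular
    {n : ℕ} (hn : 1 ≤ n) (A : Subalgebra ℂ (Matrix (Fin n) (Fin n) ℂ))
    (hclosed : IsClosed (A : Set (Matrix (Fin n) (Fin n) ℂ)))
    (hlog : IsLogmodular A) :
    ∃ U ∈ Matrix.unitaryGroup (Fin n) ℂ, ∃ f : Fin n → ℕ, Monotone f ∧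
      {x : Matrix (Fin n) (Fin n) ℂ | ∃ a ∈ A, x = U * a * star U} =
        {M : Matrix (Fin n) (Fin n) ℂ | ∀ i j : Fin n, f j < f i → M i j = 0} := by
  classical
  obtain ⟨u, hu, huA⟩ := hlog.exists_orthonormal_vecMulVec_mem hclosed
  let R : Fin n → Fin n → Prop := fun i j => vecMulVec (u i) (star (u j)) ∈ A
  have hrefl : ∀ i, R i i := huA
  have htrans : ∀ {i j k}, R i j → R j k → R i k := by
    intro i j k hij hjk
    have := A.mul_mem hij hjk
    rwa [vecMulVec_mul_vecMulVec, hu, if_pos rfl, one_smul] at this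
  have htotal : ∀ i j, R i j ∨ R j i := by
    intro i j
    by_contra! hR
    obtain ⟨hij, hji⟩ := hR
    have hne : i ≠ j := by
      rintro rfl
      exact hij (hrefl i)
    let G := A.rankOneLeft (u i) ⊓ A.rankOneLeft (u j)
    have hG : ∀ a ∈ A, ∀ x ∈ G, a *ᵥ x ∈ G := fun a ha x hx =>
      ⟨Subalgebra.mulVec_mem_rankOneLeft a ha x hx.1, Subalgebra.mulVec_mem_rankOneLeft a ha x hx.2⟩
    have horth : ∀ k, u k ∉ G → ∀ x ∈ G, star x ⬝ᵥ u k = 0 := by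
      intro k hk x hx
      have h1 := hG _ (huA k) x hx
      rw [vecMulVec_mulVec] at h1
      by_contra h0
      have h2 : star (u k) ⬝ᵥ x ≠ 0 := by
        intro h
        apply h0
        rw [star_dotProduct, h, star_zero]
      refine hk ?_
      simpa [h2] using G.smul_mem (star (u k) ⬝ᵥ x)⁻¹ h1
    have hiG : u i ∉ G := fun h => hij h.2
    have hjG : u j ∉ G := fun h => hji h.1
    have hv : u i + u j ≠ 0 := by
      intro h
      have h1 := congrArg (fun x => star (u i) ⬝ᵥ x) h
      simp [dotProduct_add, hu, hne] at h1
    obtain ⟨w, hwG, hw⟩ := hlog.exists_vecMulVec_mem hclosed hG hv (fun x hx => by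
      rw [dotProduct_add, horth i hiG x hx, horth j hjG x hx, add_zero])
    refine hwG ⟨?_, ?_⟩
    · have := A.mul_mem hw (huA i)
      rwa [vecMulVec_mul_vecMulVec, star_add, add_dotProduct, hu, hu, if_pos rfl, if_neg hne.symm,
        add_zero, one_smul] at this
    · have := A.mul_mem hw (huA j)
      rwa [vecMulVec_mul_vecMulVec, star_add, add_dotProduct, hu, hu, if_pos rfl, if_neg hne,
        zero_add, one_smul] at this
  let g : Fin n → ℕ := fun i => (Finset.univ.filter fun k => R k i).card
  have hg : ∀ i j, g j < g i ↔ ¬ R i j := by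
    intro i j
    constructor
    · intro h hR
      refine absurd h (not_lt.2 (Finset.card_le_card fun k hk => ?_))
      simp only [Finset.mem_filter, Finset.mem_univ, true_and] at hk ⊢
      exact htrans hk hR
    · intro hR
      have hji := (htotal i j).resolve_left hR
      refine Finset.card_lt_card ((Finset.ssubset_iff_of_subset fun k hk => ?_).2 ⟨i, ?_, ?_⟩)
      · simp only [Finset.mem_filter, Finset.mem_univ, true_and] at hk ⊢
        exact htrans hk hji
      · simpa using hrefl i
      · simpa using hR
  let σ := Tuple.sort g
  let V : Matrix (Fin n) (Fin n) ℂ := Matrix.of fun i j => star (u (σ i) j)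
  have hVV : V * star V = 1 := by
    ext i j
    have := hu (σ i) (σ j)
    simp only [EmbeddingLike.apply_eq_iff_eq] at this
    rw [Matrix.one_apply, ← this]
    simp [Matrix.mul_apply, V, dotProduct]
  have hVV' : star V * V = 1 := mul_eq_one_comm.1 hVV
  have hentry : ∀ a i j, (V * a * star V) i j = star (u (σ i)) ⬝ᵥ (a *ᵥ u (σ j)) := by
    intro a i j
    rw [mul_assoc]
    simp [Matrix.mul_apply, V, dotProduct, mulVec]
  refine ⟨V, (Matrix.mem_unitaryGroup_iff).2 hVV, g ∘ σ, Tuple.monotone_sort g, ?_⟩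
  ext M
  constructor
  · rintro ⟨a, ha, rfl⟩ i j hij
    rw [hentry]
    by_contra h0
    refine (hg _ _).1 hij ?_
    have h1 := A.mul_mem (huA (σ i)) (A.mul_mem ha (huA (σ j)))
    rw [mul_vecMulVec, vecMulVec_mul_vecMulVec] at h1
    simpa [vecMulVec_smul, h0] using A.smul_mem h1 (star (u (σ i)) ⬝ᵥ (a *ᵥ u (σ j)))⁻¹
  · intro hM
    refine ⟨star V * M * V, ?_, ?_⟩
    · have hsum : star V * M * V =
          ∑ i, ∑ j, M i j • vecMulVec (u (σ i)) (star (u (σ j))) := by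
        ext k l
        simp only [Matrix.mul_apply, Matrix.sum_apply, Matrix.smul_apply, vecMulVec_apply, V,
          Finset.sum_mul]
        rw [Finset.sum_comm]
        refine Finset.sum_congr rfl fun i _ => Finset.sum_congr rfl fun j _ => ?_
        simp
        ring
      rw [hsum]
      refine A.sum_mem fun i _ => A.sum_mem fun j _ => ?_
      by_cases hR : R (σ i) (σ j)
      · exact A.smul_mem hR _
      · rw [hM i j ((hg _ _).2 hR), zero_smul]
        exact A.zero_mem
    · rw [show V * (star V * M * V) * star V = (V * star V) * M * (V * star V) by
        simp only [mul_assoc], hVV, one_mul, mul_one]
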